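/- Let θ : ℕ → ℝ ∪ {∞} satisfy θ(1) ≥ 2 and θ(n) ≥ P⁺(n) for all n ≥ 2, where P⁺(n) is the largest prime factor of n. Let χ be the characteristic function of the associated set 𝓑 and B(x) = #{n ≤ x : n ∈ 𝓑}. If B(x) = o(x) as x → ∞, then the series Σ_{n ≥ 1} χ(n)·(1/n)·∏_{p ≤ θ(n)} (1 − 1/p) converges with sum equal to 1, where p runs over primes. -/

import Mathlib

open scoped BigOperators
open Classical

/-- Membership in the set `𝓑` associated to `θ`: `n = 1`, or `n ≥ 2` whose prime
factorization `p₁^{α₁}···p_k^{α_k}` (with `p₁ < ⋯ < p_k`) satisfies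
`p_{j+1} ≤ θ(p₁^{α₁}···p_j^{α_j})` for all `0 ≤ j < k`; equivalently, every prime `p`
dividing `n` satisfies `p ≤ θ(m)` where `m` is the part of `n` composed of primes `< p`. -/
def BMem (θ : ℕ → WithTop ℝ) (n : ℕ) : Prop :=
  0 < n ∧ ∀ p ∈ n.primeFactors,
    ((p : ℝ) : WithTop ℝ) ≤ θ (∏ q ∈ n.primeFactors.filter (fun q => q < p), q ^ n.factorization q)

/-- `B(x)`, the number of elements of `𝓑` that are at most `x`. -/
noncomputable def Bcount (θ : ℕ → WithTop ℝ) (x : ℝ) : ℕ :=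
  Nat.card {n : ℕ | BMem θ n ∧ (n : ℝ) ≤ x}

open Filter Topology

/-- The local factor at `p` of the Euler product of `ζ(s)⁻¹`, restricted to the primes in `T`. -/
noncomputable def eulerFactor (T : ℕ → Prop) (s : ℝ) (p : ℕ) : ℝ :=
  if p.Prime ∧ T p then 1 - (p : ℝ) ^ (-s) else 1

section EulerFactor

variable {T : ℕ → Prop} {s t : ℝ} {p : ℕ}

lemma rpow_neg_lt_one_of_prime (hs : 0 < s) (hp : p.Prime) : (p : ℝ) ^ (-s) < 1 :=
  Real.rpow_lt_one_of_one_lt_of_neg (by exact_mod_cast hp.one_lt) (by linarith)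

lemma eulerFactor_pos (hs : 0 < s) : 0 < eulerFactor T s p := by
  unfold eulerFactor
  split_ifs with h
  · linarith [rpow_neg_lt_one_of_prime hs h.1]
  · exact one_pos

lemma eulerFactor_le_one : eulerFactor T s p ≤ 1 := by
  unfold eulerFactor
  split_ifs with h
  · linarith [Real.rpow_nonneg (Nat.cast_nonneg (α := ℝ) p) (-s)]
  · exact le_rfl

lemma eulerFactor_mono (hst : s ≤ t) : eulerFactor T s p ≤ eulerFactor T t p := by
  unfold eulerFactor
  split_ifs with h
  · gcongr
    exact_mod_cast h.1.one_le
  · exact le_rfl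

lemma hasProd_eulerFactor (T : ℕ → Prop) (hs : 0 < s) :
    HasProd (eulerFactor T s) (∏' p, eulerFactor T s p) := by
  apply Multipliable.hasProd
  have hanti : Antitone fun u : Finset ℕ => ∏ p ∈ u, eulerFactor T s p := fun u v huv =>
    Finset.prod_le_prod_of_subset_of_le_one huv (fun _ _ => (eulerFactor_pos hs).le)
      (fun _ _ _ => eulerFactor_le_one)
  exact ⟨_, tendsto_atTop_ciInf hanti
    ⟨0, by rintro _ ⟨u, rfl⟩; exact Finset.prod_nonneg fun _ _ => (eulerFactor_pos hs).le⟩⟩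

lemma tprod_eulerFactor_le_prod (hs : 0 < s) (u : Finset ℕ) :
    ∏' p, eulerFactor T s p ≤ ∏ p ∈ u, eulerFactor T s p := by
  have h : Tendsto (fun v : Finset ℕ => ∏ p ∈ v, eulerFactor T s p) atTop
    (𝓝 (∏' p, eulerFactor T s p)) := hasProd_eulerFactor T hs
  refine le_of_tendsto h ?_
  filter_upwards [eventually_ge_atTop u] with v hv
  exact Finset.prod_le_prod_of_subset_of_le_one hv (fun _ _ => (eulerFactor_pos hs).le)
    (fun _ _ _ => eulerFactor_le_one)

lemma tprod_eulerFactor_nonneg (hs : 0 < s) : 0 ≤ ∏' p, eulerFactor T s p :=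
  ge_of_tendsto' (show Tendsto _ _ _ from hasProd_eulerFactor T hs)
    fun _ => Finset.prod_nonneg fun _ _ => (eulerFactor_pos hs).le

lemma tprod_eulerFactor_mono (hs : 0 < s) (hst : s ≤ t) :
    ∏' p, eulerFactor T s p ≤ ∏' p, eulerFactor T t p :=
  le_of_tendsto_of_tendsto' (show Tendsto _ _ _ from hasProd_eulerFactor T hs)
    (show Tendsto _ _ _ from hasProd_eulerFactor T (hs.trans_le hst)) fun _ =>
      Finset.prod_le_prod (fun _ _ => (eulerFactor_pos hs).le) fun _ _ => eulerFactor_mono hst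

lemma tprod_eulerFactor_eq_prod {N : ℕ} (hT : ∀ p, T p → p ≤ N) :
    ∏' p, eulerFactor T s p = ∏ p ∈ Finset.range (N + 1), eulerFactor T s p := by
  refine tprod_eq_prod fun p hp => ?_
  rw [eulerFactor, if_neg]
  rintro ⟨-, h⟩
  exact hp (Finset.mem_range.2 (Nat.lt_succ_of_le (hT p h)))

/-- The completely multiplicative function `n ↦ n⁻ˢ` restricted to the integers without prime
factors in `T`. -/
noncomputable def roughHom (T : ℕ → Prop) (s : ℝ) (hs : s ≠ 0) : ℕ →*₀ ℝ where
  toFun n := if ∀ p, p.Prime → p ∣ n → ¬ T p then (n : ℝ) ^ (-s) else 0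
  map_zero' := by simp [Real.zero_rpow (neg_ne_zero.2 hs)]
  map_one' := by
    rw [if_pos]
    · simp
    · exact fun p hp h => absurd h hp.not_dvd_one
  map_mul' a b := by
    have key : (∀ p, p.Prime → p ∣ a * b → ¬ T p) ↔
        (∀ p, p.Prime → p ∣ a → ¬ T p) ∧ (∀ p, p.Prime → p ∣ b → ¬ T p) := by
      constructor
      · exact fun h => ⟨fun p hp hd => h p hp (hd.mul_right b),
          fun p hp hd => h p hp (hd.mul_left a)⟩
      · rintro ⟨h1, h2⟩ p hp hd
        exact (hp.dvd_mul.1 hd).elim (h1 p hp) (h2 p hp)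
    simp only [key]
    by_cases h1 : ∀ p, p.Prime → p ∣ a → ¬ T p <;> by_cases h2 : ∀ p, p.Prime → p ∣ b → ¬ T p
    · rw [if_pos ⟨h1, h2⟩, if_pos h1, if_pos h2, Nat.cast_mul,
        Real.mul_rpow (Nat.cast_nonneg a) (Nat.cast_nonneg b)]
    · rw [if_neg (fun h => h2 h.2), if_neg h2, mul_zero]
    · rw [if_neg (fun h => h1 h.1), if_neg h1, zero_mul]
    · rw [if_neg (fun h => h1 h.1), if_neg h1, zero_mul]

lemma roughHom_apply (hs : s ≠ 0) (n : ℕ) : roughHom T s hs n =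
    if ∀ p, p.Prime → p ∣ n → ¬ T p then (n : ℝ) ^ (-s) else 0 := rfl

lemma summable_rpow_neg (hs : 1 < s) : Summable fun n : ℕ => (n : ℝ) ^ (-s) :=
  Real.summable_nat_rpow.2 (by linarith)

lemma summable_norm_roughHom (T : ℕ → Prop) (hs : 1 < s) :
    Summable fun n => ‖roughHom T s (by linarith) n‖ := by
  refine Summable.of_nonneg_of_le (fun _ => norm_nonneg _) (fun n => ?_) (summable_rpow_neg hs)
  have h0 := Real.rpow_nonneg (Nat.cast_nonneg (α := ℝ) n) (-s)
  rw [roughHom_apply]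
  split_ifs
  · rw [Real.norm_of_nonneg h0]
  · simpa using h0

/-- The Euler product for the sum over integers without prime factors in `T`. -/
lemma tsum_roughHom (T : ℕ → Prop) (hs : 1 < s) :
    ∑' n, roughHom T s (by linarith) n =
      (∏' p, eulerFactor T s p) * ∑' n : ℕ, (n : ℝ) ^ (-s) := by
  have hs0 : s ≠ 0 := by linarith
  have hT := EulerProduct.eulerProduct_completely_multiplicative_hasProd
    (summable_norm_roughHom T hs)
  have hF := EulerProduct.eulerProduct_completely_multiplicative_hasProd
    (summable_norm_roughHom (fun _ => False) hs)
  change HasProd ((fun p : ℕ => (1 - roughHom T s hs0 p)⁻¹) ∘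
    Subtype.val (p := (· ∈ {x | Nat.Prime x}))) _ at hT
  change HasProd ((fun p : ℕ => (1 - roughHom (fun _ => False) s hs0 p)⁻¹) ∘
    Subtype.val (p := (· ∈ {x | Nat.Prime x}))) _ at hF
  rw [hasProd_subtype_iff_mulIndicator] at hT hF
  have hsum : ∑' n, roughHom (fun _ => False) s hs0 n = ∑' n : ℕ, (n : ℝ) ^ (-s) :=
    tsum_congr fun n => by simp [roughHom_apply]
  rw [← hsum]
  refine hT.unique (((hasProd_eulerFactor T (by linarith : 0 < s)).mul hF).congr_fun fun p => ?_)
  by_cases hp : p.Prime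
  · have hne : 1 - (p : ℝ) ^ (-s) ≠ 0 := by
      linarith [rpow_neg_lt_one_of_prime (by linarith : 0 < s) hp]
    have hdvd : (∀ q, q.Prime → q ∣ p → ¬ T q) ↔ ¬ T p :=
      ⟨fun h => h p hp dvd_rfl, fun h q hq hqp => (Nat.prime_dvd_prime_iff_eq hq hp).1 hqp ▸ h⟩
    by_cases hTp : T p <;> simp [hp, roughHom_apply, eulerFactor, hdvd, hTp, hne]
  · simp [hp, eulerFactor]

end EulerFactor

lemma pow_div_dvd_factorial (p N : ℕ) (hp : p ≠ 0) : p ^ (N / p) ∣ N.factorial := by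
  have key : ∀ k, p ^ k ∣ (p * k).factorial := by
    intro k
    induction k with
    | zero => simp
    | succ k ih =>
      rw [pow_succ, Nat.mul_succ]
      exact (mul_dvd_mul ih (Nat.dvd_factorial (Nat.pos_of_ne_zero hp) le_rfl)).trans
        (Nat.factorial_mul_factorial_dvd_factorial_add _ _)
  exact (key _).trans (Nat.factorial_dvd_factorial (Nat.mul_div_le N p))

/-- The upper bound in Mertens' first theorem. -/
lemma sum_log_div_le {N : ℕ} (hN : 1 ≤ N) :
    ∑ p ∈ Finset.range (N + 1) with p.Prime, Real.log p / p ≤ Real.log N + Real.log 4 := by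
  have hN0 : (0 : ℝ) < N := by exact_mod_cast hN
  have hfac : ∑ p ∈ Finset.range (N + 1) with p.Prime, ((N / p : ℕ) : ℝ) * Real.log p ≤
      N * Real.log N := by
    have hd : ∏ p ∈ Finset.range (N + 1) with p.Prime, p ^ (N / p) ≤ N.factorial := by
      have hN0 := N.factorial_ne_zero
      calc ∏ p ∈ Finset.range (N + 1) with p.Prime, p ^ (N / p)
          ≤ ∏ p ∈ Finset.range (N + 1) with p.Prime, p ^ N.factorial.factorization p := by
            refine Finset.prod_le_prod' fun p hp => ?_
            have hp' : p.Prime := (Finset.mem_filter.1 hp).2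
            exact Nat.pow_le_pow_right hp'.pos ((hp'.pow_dvd_iff_le_factorization hN0).1
              (pow_div_dvd_factorial p N hp'.ne_zero))
        _ ≤ ∏ p ∈ N.factorial.primeFactors, p ^ N.factorial.factorization p := by
            refine Finset.prod_le_prod_of_subset_of_one_le' (fun p hp => ?_) fun p hp _ =>
              Nat.one_le_pow _ _ (Nat.prime_of_mem_primeFactors hp).pos
            obtain ⟨hpN, hp'⟩ := Finset.mem_filter.1 hp
            exact Nat.mem_primeFactors.2 ⟨hp', Nat.dvd_factorial hp'.pos
              (Nat.lt_succ_iff.1 (Finset.mem_range.1 hpN)), hN0⟩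
        _ = N.factorial := Nat.prod_factorization_pow_eq_self hN0
    have h2 : ((∏ p ∈ Finset.range (N + 1) with p.Prime, p ^ (N / p) : ℕ) : ℝ) ≤ (N : ℝ) ^ N := by
      exact_mod_cast hd.trans (Nat.factorial_le_pow N)
    have h3 := Real.log_le_log (by
      exact_mod_cast Finset.prod_pos fun p hp =>
        pow_pos (Nat.Prime.pos (Finset.mem_filter.1 hp).2) _) h2
    rw [Real.log_pow, Nat.cast_prod, Real.log_prod] at h3
    · simpa [Real.log_pow] using h3
    · intro p hp
      have := Nat.Prime.ne_zero (Finset.mem_filter.1 hp).2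
      positivity
  have htheta : ∑ p ∈ Finset.range (N + 1) with p.Prime, Real.log p ≤ Real.log 4 * N := by
    have := Chebyshev.theta_le_log4_mul_x hN0.le
    rw [Chebyshev.theta_eq_sum_Icc, Nat.floor_natCast] at this
    refine le_trans (le_of_eq ?_) this
    refine Finset.sum_congr ?_ fun _ _ => rfl
    ext p
    simp
  have hle : ∀ p ∈ (Finset.range (N + 1)).filter Nat.Prime,
      N * (Real.log p / p) ≤ ((N / p : ℕ) : ℝ) * Real.log p + Real.log p := by
    intro p hp
    have hp' := (Finset.mem_filter.1 hp).2
    have hp0 : (0 : ℝ) < p := by exact_mod_cast hp'.pos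
    have h1 : (N : ℝ) / p ≤ ((N / p : ℕ) : ℝ) + 1 := by
      rw [← Nat.floor_div_eq_div (K := ℝ)]
      exact (Nat.lt_floor_add_one _).le
    have hl : 0 ≤ Real.log p := Real.log_nonneg (by exact_mod_cast hp'.one_le)
    calc N * (Real.log p / p) = (N / p) * Real.log p := by ring
      _ ≤ (((N / p : ℕ) : ℝ) + 1) * Real.log p := by gcongr
      _ = _ := by ring
  have h := Finset.sum_le_sum hle
  rw [← Finset.mul_sum, Finset.sum_add_distrib] at h
  have : N * ∑ p ∈ Finset.range (N + 1) with p.Prime, Real.log p / p ≤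
      N * (Real.log N + Real.log 4) := by linarith
  exact le_of_mul_le_mul_left this hN0

/-- The part of `n` composed of the primes satisfying `P`. -/
noncomputable def primePart (P : ℕ → Prop) (n : ℕ) : ℕ :=
  ∏ q ∈ n.primeFactors.filter P, q ^ n.factorization q

section PrimePart

variable {P Q : ℕ → Prop} {n m p : ℕ}

lemma factorization_primePart : (primePart P n).factorization = n.factorization.filter P := by
  have h : primePart P n = (n.factorization.filter P).prod (· ^ ·) := by
    rw [primePart, Finsupp.prod, Finsupp.support_filter, Nat.support_factorization]
    exact Finset.prod_congr rfl fun q hq => by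
      rw [Finsupp.filter_apply_pos _ _ (Finset.mem_filter.1 hq).2]
  rw [h]
  exact Nat.prod_pow_factorization_eq_self fun q hq =>
    Nat.prime_of_mem_primeFactors (Finset.mem_filter.1 (by
      rwa [Finsupp.support_filter, Nat.support_factorization] at hq)).1

lemma primePart_pos : 0 < primePart P n :=
  Finset.prod_pos fun _ hq =>
    pow_pos (Nat.prime_of_mem_primeFactors (Finset.mem_filter.1 hq).1).pos _

lemma primeFactors_primePart : (primePart P n).primeFactors = n.primeFactors.filter P := by
  rw [← Nat.support_factorization, factorization_primePart, Finsupp.support_filter,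
    Nat.support_factorization]

lemma primePart_dvd (hn : n ≠ 0) : primePart P n ∣ n := by
  rw [← Nat.factorization_le_iff_dvd primePart_pos.ne' hn, factorization_primePart]
  intro q
  rw [Finsupp.filter_apply]
  split_ifs <;> simp

/-- Prime parts of two numbers agree when the relevant prime factors agree. -/
lemma primePart_congr
    (h : ∀ q, (if P q then n.factorization q else 0) = if Q q then m.factorization q else 0) :
    primePart P n = primePart Q m := by
  refine Nat.eq_of_factorization_eq primePart_pos.ne' primePart_pos.ne' fun q => ?_
  rw [factorization_primePart, factorization_primePart, Finsupp.filter_apply, Finsupp.filter_apply]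
  exact h q

lemma primePart_eq_self (hn : n ≠ 0) (h : ∀ q ∈ n.primeFactors, P q) : primePart P n = n := by
  rw [primePart, Finset.filter_true_of_mem h]
  exact Nat.prod_factorization_pow_eq_self hn

end PrimePart

section Decomposition

variable {θ : ℕ → WithTop ℝ} {n c r : ℕ}

/-- The prime `p` lies below the bound `θ n`. -/
def LeTheta (θ : ℕ → WithTop ℝ) (n p : ℕ) : Prop := ((p : ℝ) : WithTop ℝ) ≤ θ n

lemma LeTheta.mono {p q : ℕ} (h : LeTheta θ n q) (hpq : p ≤ q) : LeTheta θ n p := by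
  refine le_trans ?_ h
  exact_mod_cast hpq

/-- All primes `p ≤ q` dividing `n` satisfy `p ≤ θ(m)`, `m` the part of `n` below `p`. -/
def GoodUpTo (θ : ℕ → WithTop ℝ) (n q : ℕ) : Prop :=
  ∀ p ∈ n.primeFactors, p ≤ q → LeTheta θ (primePart (· < p) n) p

/-- The largest initial divisor of `n` lying in `𝓑`. -/
noncomputable def maxPrefix (θ : ℕ → WithTop ℝ) (n : ℕ) : ℕ := primePart (GoodUpTo θ n) n

lemma bMem_iff : BMem θ n ↔ 0 < n ∧ ∀ p ∈ n.primeFactors, LeTheta θ (primePart (· < p) n) p := by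
  unfold BMem LeTheta primePart
  convert Iff.rfl

lemma bMem_maxPrefix : BMem θ (maxPrefix θ n) := by
  refine bMem_iff.2 ⟨primePart_pos, fun p hp => ?_⟩
  rw [maxPrefix, primeFactors_primePart, Finset.mem_filter] at hp
  obtain ⟨hpn, hgood⟩ := hp
  have : primePart (· < p) (maxPrefix θ n) = primePart (· < p) n := by
    refine primePart_congr fun q => ?_
    by_cases hq : q < p
    · have : GoodUpTo θ n q := fun r hr hrq => hgood r hr (hrq.trans hq.le)
      simp [hq, maxPrefix, factorization_primePart, this]
    · simp [hq]
  rw [this]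
  exact hgood p hpn le_rfl

lemma not_leTheta_of_dvd_div_maxPrefix (hn : n ≠ 0) (hr : n = maxPrefix θ n * r) {p : ℕ}
    (hp : p.Prime) (hpr : p ∣ r) : ¬ LeTheta θ (maxPrefix θ n) p := by
  have hr0 : r ≠ 0 := by rintro rfl; simp at hr; exact hn hr
  have hfac : n.factorization p = (maxPrefix θ n).factorization p + r.factorization p := by
    conv_lhs => rw [hr]
    rw [Nat.factorization_mul (show maxPrefix θ n ≠ 0 from primePart_pos.ne') hr0,
      Finsupp.add_apply]
  have hpos := hp.factorization_pos_of_dvd hr0 hpr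
  have hbad : ¬ GoodUpTo θ n p := by
    intro hg
    have : (maxPrefix θ n).factorization p = n.factorization p := by
      rw [maxPrefix, factorization_primePart, Finsupp.filter_apply_pos _ _ hg]
    omega
  have hex : ∃ q, q ∈ n.primeFactors ∧ q ≤ p ∧ ¬ LeTheta θ (primePart (· < q) n) q := by
    unfold GoodUpTo at hbad
    push Not at hbad
    exact hbad
  obtain ⟨hqn, hqp, hq⟩ := Nat.find_spec hex
  have hmin : ∀ t < Nat.find hex, GoodUpTo θ n t := by
    intro t ht u hu hut
    by_contra hcon
    exact Nat.find_min hex (hut.trans_lt ht) ⟨hu, (hut.trans ht.le).trans hqp, hcon⟩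
  have heq : primePart (· < Nat.find hex) n = maxPrefix θ n := by
    refine primePart_congr fun t => ?_
    by_cases ht : t < Nat.find hex
    · rw [if_pos ht, if_pos (hmin t ht)]
    · have : ¬ GoodUpTo θ n t := fun hg => hq (hg _ hqn (not_lt.1 ht))
      rw [if_neg ht, if_neg this]
  rw [heq] at hq
  exact fun h => hq (h.mono hqp)

lemma maxPrefix_mul (hθ2 : ∀ n : ℕ, 2 ≤ n → ∀ p ∈ n.primeFactors, LeTheta θ n p)
    (hc : BMem θ c) (hr0 : r ≠ 0) (hr : ∀ p, p.Prime → p ∣ r → ¬ LeTheta θ c p) :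
    maxPrefix θ (c * r) = c := by
  obtain ⟨hc0, hcgood⟩ := bMem_iff.1 hc
  have hlt : ∀ q ∈ c.primeFactors, ∀ p ∈ r.primeFactors, q < p := by
    intro q hq p hp
    have hc2 : 2 ≤ c := (Nat.prime_of_mem_primeFactors hq).two_le.trans
      (Nat.le_of_mem_primeFactors hq)
    by_contra hcon
    exact hr p (Nat.prime_of_mem_primeFactors hp) (Nat.dvd_of_mem_primeFactors hp)
      ((hθ2 c hc2 q hq).mono (not_lt.1 hcon))
  have hfac : ∀ t, (c * r).factorization t = c.factorization t + r.factorization t := fun t => by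
    rw [Nat.factorization_mul hc0.ne' hr0, Finsupp.add_apply]
  have hzero : ∀ {m t : ℕ}, t ∉ m.primeFactors → m.factorization t = 0 := fun h => by
    rwa [← Finsupp.notMem_support_iff, Nat.support_factorization]
  have hpf : (c * r).primeFactors = c.primeFactors ∪ r.primeFactors :=
    Nat.primeFactors_mul hc0.ne' hr0
  have hgood_c : ∀ q ∈ c.primeFactors, GoodUpTo θ (c * r) q := by
    intro q hq p hp hpq
    rw [hpf, Finset.mem_union] at hp
    have hpc : p ∈ c.primeFactors := hp.resolve_right fun h => (hlt q hq p h).not_ge hpq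
    have : primePart (· < p) (c * r) = primePart (· < p) c := by
      refine primePart_congr fun t => ?_
      by_cases ht : t < p
      · rw [if_pos ht, if_pos ht, hfac, hzero (m := r) fun h => (hlt p hpc t h).not_gt ht, add_zero]
      · rw [if_neg ht, if_neg ht]
    rw [this]
    exact hcgood p hpc
  have hbad_r : ∀ q ∈ r.primeFactors, ¬ GoodUpTo θ (c * r) q := by
    intro q hq hgood
    have hne : r.primeFactors.Nonempty := ⟨q, hq⟩
    set p := r.primeFactors.min' hne
    have hp : p ∈ r.primeFactors := Finset.min'_mem _ _
    have hpart : primePart (· < p) (c * r) = primePart (fun _ => True) c := by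
      refine primePart_congr fun t => ?_
      by_cases ht : t < p
      · have : t ∉ r.primeFactors := fun h => (Finset.min'_le _ _ h).not_gt ht
        rw [if_pos ht, if_pos trivial, hfac, hzero this, add_zero]
      · have : t ∉ c.primeFactors := fun h => ht (hlt t h p hp)
        rw [if_neg ht, if_pos trivial, hzero this]
    have := hgood p (by rw [hpf]; exact Finset.mem_union_right _ hp) (Finset.min'_le _ _ hq)
    rw [hpart, primePart_eq_self hc0.ne' fun _ _ => trivial] at this
    exact hr p (Nat.prime_of_mem_primeFactors hp) (Nat.dvd_of_mem_primeFactors hp) this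
  calc maxPrefix θ (c * r) = primePart (fun _ => True) c := by
        refine primePart_congr fun t => ?_
        by_cases htc : t ∈ c.primeFactors
        · rw [if_pos (hgood_c t htc), if_pos trivial, hfac,
            hzero (m := r) fun h => (hlt t htc t h).false, add_zero]
        · rw [if_pos trivial, hzero htc]
          by_cases htr : t ∈ r.primeFactors
          · rw [if_neg (hbad_r t htr)]
          · rw [hfac, hzero htc, hzero htr]; simp
    _ = c := primePart_eq_self hc0.ne' fun _ _ => trivial

end Decomposition

section EulerFactorBounds

variable {T : ℕ → Prop} {s : ℝ}

/-- If all primes up to `exp(1/(s-1))` lie in `T`, the Euler product over `T` is `O(s-1)`. -/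
lemma tprod_eulerFactor_le_mul_sub_one (hs : 1 < s)
    (hT : ∀ p : ℕ, p.Prime → (p : ℝ) ≤ Real.exp (1 / (s - 1)) → T p) :
    ∏' p, eulerFactor T s p ≤ Real.exp 1 * (s - 1) := by
  have hs0 : 0 < s - 1 := by linarith
  set y := Real.exp (1 / (s - 1)) with hy
  have hsne : s ≠ 0 := by linarith
  set N := ⌊y⌋₊ with hN
  have hpart : ∏ p ∈ Finset.range (N + 1), eulerFactor T s p =
      (∏ p ∈ (N + 1).primesBelow, (1 - (p : ℝ) ^ (-s))⁻¹)⁻¹ := by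
    rw [← Finset.prod_inv_distrib, Nat.primesBelow, Finset.prod_filter]
    refine Finset.prod_congr rfl fun p hp => ?_
    unfold eulerFactor
    by_cases hp' : p.Prime
    · have : T p := hT p hp' ((Nat.le_floor_iff (Real.exp_pos _).le).1
        (Nat.lt_succ_iff.1 (Finset.mem_range.1 hp)))
      simp [hp', this]
    · simp [hp']
  have hsm := EulerProduct.summable_and_hasSum_smoothNumbers_prod_primesBelow_geometric
    (f := (roughHom (fun _ => False) s hsne : ℕ →* ℝ)) (fun {p} hp => by
      have := rpow_neg_lt_one_of_prime (by linarith : 0 < s) hp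
      have h0 := Real.rpow_nonneg (Nat.cast_nonneg (α := ℝ) p) (-s)
      simpa [roughHom_apply, abs_of_nonneg h0] using this) (N + 1)
  have hsum : HasSum (fun m : (N + 1).smoothNumbers => ((m : ℕ) : ℝ) ^ (-s))
      (∏ p ∈ (N + 1).primesBelow, (1 - (p : ℝ) ^ (-s))⁻¹) := by
    simpa [roughHom_apply] using hsm.2
  have hmem : ∀ n ∈ Finset.Icc 1 N, n ∈ (N + 1).smoothNumbers := fun n hn => by
    obtain ⟨h1, h2⟩ := Finset.mem_Icc.1 hn
    exact Nat.mem_smoothNumbers_of_lt h1 (Nat.lt_succ_of_le h2)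
  have hle : ∑ n ∈ Finset.Icc 1 N, (n : ℝ) ^ (-s) ≤
      ∏ p ∈ (N + 1).primesBelow, (1 - (p : ℝ) ^ (-s))⁻¹ := by
    rw [← Finset.sum_subtype_of_mem (fun n : ℕ => (n : ℝ) ^ (-s)) hmem]
    exact sum_le_hasSum _ (fun _ _ => Real.rpow_nonneg (Nat.cast_nonneg _) _) hsum
  have hlow : Real.exp (-1) * (1 / (s - 1)) ≤ ∑ n ∈ Finset.Icc 1 N, (n : ℝ) ^ (-s) := by
    have hharm := log_le_harmonic_floor y (Real.exp_pos _).le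
    rw [hy, Real.log_exp, ← hy, ← hN, harmonic_eq_sum_Icc] at hharm
    push_cast at hharm
    calc Real.exp (-1) * (1 / (s - 1)) ≤ Real.exp (-1) * ∑ n ∈ Finset.Icc 1 N, (n : ℝ)⁻¹ := by
          gcongr
      _ = ∑ n ∈ Finset.Icc 1 N, Real.exp (-1) * (n : ℝ)⁻¹ := Finset.mul_sum ..
      _ ≤ _ := by
          refine Finset.sum_le_sum fun n hn => ?_
          obtain ⟨h1, h2⟩ := Finset.mem_Icc.1 hn
          have hn0 : (0 : ℝ) < n := by exact_mod_cast h1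
          have hlog : Real.log n ≤ 1 / (s - 1) := by
            rw [Real.log_le_iff_le_exp hn0]
            exact (Nat.le_floor_iff (Real.exp_pos _).le).1 h2
          have hmul : (s - 1) * Real.log n ≤ 1 := by
            rw [le_div_iff₀ hs0] at hlog; linarith
          rw [Real.rpow_def_of_pos hn0, ← Real.exp_log (inv_pos.2 hn0), Real.log_inv,
            ← Real.exp_add]
          gcongr
          linarith
  calc ∏' p, eulerFactor T s p ≤ ∏ p ∈ Finset.range (N + 1), eulerFactor T s p :=
        tprod_eulerFactor_le_prod (by linarith) _
    _ ≤ (Real.exp (-1) * (1 / (s - 1)))⁻¹ := by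
        rw [hpart]
        exact inv_anti₀ (by positivity) (hlow.trans hle)
    _ = _ := by rw [Real.exp_neg]; field_simp

lemma eulerFactor_le_exp_mul (hs : 1 ≤ s) {p : ℕ} (hp : p.Prime) :
    eulerFactor T s p ≤ Real.exp (2 * (s - 1) * (Real.log p / p)) * eulerFactor T 1 p := by
  have hp0 : (0 : ℝ) < p := by exact_mod_cast hp.pos
  have hp2 : (2 : ℝ) ≤ p := by exact_mod_cast hp.two_le
  have hlog : 0 ≤ Real.log p := Real.log_nonneg (by linarith)
  set L := (s - 1) * (Real.log p / p) with hL
  have hL0 : 0 ≤ L := mul_nonneg (by linarith) (by positivity)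
  have hexp : 1 + 2 * L ≤ Real.exp (2 * (s - 1) * (Real.log p / p)) := by
    have := Real.add_one_le_exp (2 * L)
    rw [show 2 * (s - 1) * (Real.log p / p) = 2 * L by rw [hL]; ring]
    linarith
  unfold eulerFactor
  split_ifs with h
  · have hinv : (p : ℝ) ^ (-1 : ℝ) = 1 / p := by rw [Real.rpow_neg_one, one_div]
    have hinv2 : 1 / (p : ℝ) ≤ 1 / 2 := one_div_le_one_div_of_le two_pos hp2
    have hdiff : 1 / (p : ℝ) - L ≤ (p : ℝ) ^ (-s) := by
      have h1 : (p : ℝ) ^ (-s) = 1 / p * Real.exp (-(s - 1) * Real.log p) := by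
        rw [show -s = -1 + -(s - 1) by ring, Real.rpow_add hp0, hinv, Real.rpow_def_of_pos hp0,
          mul_comm (Real.log _)]
      have h2 := Real.add_one_le_exp (-(s - 1) * Real.log p)
      calc 1 / (p : ℝ) - L = 1 / p * (-(s - 1) * Real.log p + 1) := by rw [hL]; ring
        _ ≤ _ := by rw [h1]; gcongr
    rw [hinv]
    calc 1 - (p : ℝ) ^ (-s) ≤ (1 + 2 * L) * (1 - 1 / p) := by nlinarith
      _ ≤ _ := by gcongr; linarith
  · linarith

/-- If `T` has no elements beyond `exp(1/(s-1))`, its Euler products at `s` and at `1` are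
comparable. -/
lemma tprod_eulerFactor_le_const_mul (hs : 1 < s) (hs2 : s ≤ 2)
    (hT : ∀ p : ℕ, T p → (p : ℝ) ≤ Real.exp (1 / (s - 1))) :
    ∏' p, eulerFactor T s p ≤ Real.exp (2 + 2 * Real.log 4) * ∏' p, eulerFactor T 1 p := by
  have hs0 : 0 < s - 1 := by linarith
  set N := ⌊Real.exp (1 / (s - 1))⌋₊ with hN
  have hT' : ∀ p, T p → p ≤ N := fun p hp => Nat.le_floor (hT p hp)
  have hN1 : 1 ≤ N := Nat.le_floor (by simpa using hs.le)
  have hlogN : (s - 1) * Real.log N ≤ 1 := by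
    have : Real.log N ≤ 1 / (s - 1) := by
      rw [Real.log_le_iff_le_exp (by exact_mod_cast hN1)]
      exact Nat.floor_le (Real.exp_pos _).le
    rw [le_div_iff₀ hs0] at this; linarith
  rw [tprod_eulerFactor_eq_prod hT', tprod_eulerFactor_eq_prod hT']
  have hpos : ∀ p, 0 < eulerFactor T 1 p := fun p => eulerFactor_pos one_pos
  calc ∏ p ∈ Finset.range (N + 1), eulerFactor T s p
      ≤ ∏ p ∈ Finset.range (N + 1),
        ((if p.Prime then Real.exp (2 * (s - 1) * (Real.log p / p)) else 1) *
          eulerFactor T 1 p) := by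
        refine Finset.prod_le_prod (fun p _ => (eulerFactor_pos (by linarith)).le) fun p _ => ?_
        by_cases hp : p.Prime
        · rw [if_pos hp]; exact eulerFactor_le_exp_mul hs.le hp
        · simp [eulerFactor, hp]
    _ = Real.exp (2 * (s - 1) *
          ∑ p ∈ Finset.range (N + 1) with p.Prime, Real.log p / p) *
        ∏ p ∈ Finset.range (N + 1), eulerFactor T 1 p := by
        rw [Finset.prod_mul_distrib, ← Finset.prod_filter, ← Real.exp_sum, Finset.mul_sum]
    _ ≤ _ := by
        have hm := sum_log_div_le hN1
        have hl4 : 0 ≤ Real.log 4 := Real.log_nonneg (by norm_num)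
        gcongr
        · exact Finset.prod_nonneg fun p _ => (hpos p).le
        · nlinarith

end EulerFactorBounds

section Series

variable {θ : ℕ → WithTop ℝ} {s : ℝ}

/-- The `n`-th term of the identity `∑_{n ∈ 𝓑} n⁻ˢ ∏_{p ≤ θ(n)} (1 - p⁻ˢ) = 1`. -/
noncomputable def bTerm (θ : ℕ → WithTop ℝ) (s : ℝ) (n : ℕ) : ℝ :=
  if BMem θ n then (n : ℝ) ^ (-s) * ∏' p, eulerFactor (LeTheta θ n) s p else 0

lemma bTerm_nonneg (hs : 0 < s) (n : ℕ) : 0 ≤ bTerm θ s n := by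
  unfold bTerm
  split_ifs
  · exact mul_nonneg (Real.rpow_nonneg (Nat.cast_nonneg _) _) (tprod_eulerFactor_nonneg hs)
  · exact le_rfl

/-- The integers whose largest prefix in `𝓑` is `c` are the multiples `c * r` with `r` free of
primes `p ≤ θ c`. -/
lemma tsum_maxPrefix_fiber (hθ2 : ∀ n : ℕ, 2 ≤ n → ∀ p ∈ n.primeFactors, LeTheta θ n p)
    (hs : 1 < s) (c : ℕ) :
    ∑' m : maxPrefix θ ⁻¹' {c}, ((m : ℕ) : ℝ) ^ (-s) =
      bTerm θ s c * ∑' n : ℕ, (n : ℝ) ^ (-s) := by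
  have hs0 : s ≠ 0 := by linarith
  rw [tsum_subtype (maxPrefix θ ⁻¹' {c}) (fun m : ℕ => (m : ℝ) ^ (-s))]
  by_cases hc : BMem θ c
  · have hc0 := hc.1
    have hinj : Function.Injective fun r => c * r := fun a b h => Nat.eq_of_mul_eq_mul_left hc0 h
    have hsupp : Function.support ((maxPrefix θ ⁻¹' {c}).indicator fun m : ℕ => (m : ℝ) ^ (-s)) ⊆
        Set.range fun r => c * r := by
      intro m hm
      have hmc : maxPrefix θ m = c := Set.indicator_apply_ne_zero.1 hm |>.1
      rcases eq_or_ne m 0 with rfl | hm0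
      · exact ⟨0, mul_zero c⟩
      · obtain ⟨r, hr⟩ : maxPrefix θ m ∣ m := primePart_dvd hm0
        exact ⟨r, by rw [hr, hmc]⟩
    rw [← hinj.tsum_eq hsupp, bTerm, if_pos hc, mul_assoc, ← tsum_roughHom (LeTheta θ c) hs,
      ← tsum_mul_left]
    refine tsum_congr fun r => ?_
    rcases eq_or_ne r 0 with rfl | hr0
    · simp [Set.indicator_apply, Real.zero_rpow (neg_ne_zero.2 hs0)]
    have hiff : maxPrefix θ (c * r) = c ↔ ∀ p, p.Prime → p ∣ r → ¬ LeTheta θ c p := by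
      refine ⟨fun h p hp hpr => ?_, maxPrefix_mul hθ2 hc hr0⟩
      have := not_leTheta_of_dvd_div_maxPrefix (mul_ne_zero hc0.ne' hr0)
        (show c * r = maxPrefix θ (c * r) * r by rw [h]) hp hpr
      rwa [h] at this
    rw [roughHom_apply, Set.indicator_apply, Set.mem_preimage, Set.mem_singleton_iff]
    by_cases h : maxPrefix θ (c * r) = c
    · rw [if_pos h, if_pos (hiff.1 h), Nat.cast_mul,
        Real.mul_rpow (Nat.cast_nonneg c) (Nat.cast_nonneg r)]
    · rw [if_neg h, if_neg fun hr => h (hiff.2 hr), mul_zero]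
  · have hempty : maxPrefix θ ⁻¹' {c} = ∅ := by
      refine Set.eq_empty_of_forall_notMem fun m hm => hc ?_
      rw [← Set.mem_singleton_iff.1 (Set.mem_preimage.1 hm)]
      exact bMem_maxPrefix
    simp [hempty, bTerm, hc]

lemma hasSum_bTerm (hθ2 : ∀ n : ℕ, 2 ≤ n → ∀ p ∈ n.primeFactors, LeTheta θ n p)
    (hs : 1 < s) : HasSum (bTerm θ s) 1 := by
  have hsm := summable_rpow_neg hs
  have hpos : 0 < ∑' n : ℕ, (n : ℝ) ^ (-s) :=
    hsm.tsum_pos (fun n => Real.rpow_nonneg (Nat.cast_nonneg n) _) 1 (by simp)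
  have h := hsm.hasSum.tsum_fiberwise (maxPrefix θ)
  simp only [tsum_maxPrefix_fiber hθ2 hs] at h
  have h' := h.div_const (∑' n : ℕ, (n : ℝ) ^ (-s))
  simpa [mul_div_assoc, hpos.ne'] using h'

lemma rpow_mul_bTerm_one_le (hs : 1 ≤ s) (n : ℕ) :
    (n : ℝ) ^ (1 - s) * bTerm θ 1 n ≤ bTerm θ s n := by
  unfold bTerm
  split_ifs with h
  · have hn : (0 : ℝ) < n := by exact_mod_cast h.1
    rw [← mul_assoc, ← Real.rpow_add hn, show 1 - s + -1 = -s by ring]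
    gcongr
    exact tprod_eulerFactor_mono one_pos hs
  · simp

lemma sum_bTerm_one_le (hθ2 : ∀ n : ℕ, 2 ≤ n → ∀ p ∈ n.primeFactors, LeTheta θ n p)
    (u : Finset ℕ) : ∑ n ∈ u, bTerm θ 1 n ≤ 1 := by
  have hlim : Tendsto (fun s : ℝ => ∑ n ∈ u, (n : ℝ) ^ (1 - s) * bTerm θ 1 n) (𝓝[>] 1)
      (𝓝 (∑ n ∈ u, bTerm θ 1 n)) := by
    refine tendsto_finsetSum u fun n _ => ?_
    by_cases hn : BMem θ n
    · have hn0 : (n : ℝ) ≠ 0 := by exact_mod_cast hn.1.ne'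
      have : ContinuousAt (fun s : ℝ => (n : ℝ) ^ (1 - s) * bTerm θ 1 n) 1 := by
        refine ContinuousAt.mul ?_ continuousAt_const
        exact (Real.continuousAt_const_rpow hn0).comp (by fun_prop)
      simpa using this.tendsto.mono_left nhdsWithin_le_nhds
    · simp [bTerm, hn]
  refine le_of_tendsto hlim ?_
  filter_upwards [self_mem_nhdsWithin] with s hs
  have hs : 1 < s := hs
  calc ∑ n ∈ u, (n : ℝ) ^ (1 - s) * bTerm θ 1 n ≤ ∑ n ∈ u, bTerm θ s n :=
        Finset.sum_le_sum fun n _ => rpow_mul_bTerm_one_le hs.le n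
    _ ≤ 1 := sum_le_hasSum u (fun n _ => bTerm_nonneg (by linarith) n) (hasSum_bTerm hθ2 hs)

lemma summable_bTerm_one (hθ2 : ∀ n : ℕ, 2 ≤ n → ∀ p ∈ n.primeFactors, LeTheta θ n p) :
    Summable (bTerm θ 1) :=
  summable_of_sum_le (fun n => bTerm_nonneg one_pos n) (sum_bTerm_one_le hθ2)

/-- If `𝓑` has density zero, its Dirichlet series is `o(1/(s-1))` as `s → 1⁺`. -/
lemma tendsto_sub_one_mul_tsum_bMem
    (hB : (fun x : ℝ => (Bcount θ x : ℝ)) =o[atTop] (fun x : ℝ => x)) :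
    Tendsto (fun s : ℝ => (s - 1) * ∑' n : ℕ, if BMem θ n then (n : ℝ) ^ (-s) else 0)
      (𝓝[>] 1) (𝓝 0) := by
  have hcount : ∀ n : ℕ, ∑ k ∈ Finset.Icc 1 n, (if BMem θ k then (1 : ℝ) else 0) =
      Bcount θ (n : ℝ) := by
    intro n
    rw [Finset.sum_boole, Bcount]
    have : {k : ℕ | BMem θ k ∧ (k : ℝ) ≤ n} = ((Finset.Icc 1 n).filter (BMem θ) : Finset ℕ) := by
      ext k
      simp only [Set.mem_ofPred_eq, Finset.coe_filter, Finset.mem_Icc, Nat.cast_le]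
      exact ⟨fun h => ⟨⟨h.1.1, h.2⟩, h.1⟩, fun h => ⟨h.2, h.1.2⟩⟩
    rw [this, Nat.card_coe_set_eq, Set.ncard_coe_finset]
  have hlim : Tendsto (fun n : ℕ => (∑ k ∈ Finset.Icc 1 n, (if BMem θ k then (1 : ℝ) else 0)) /
      (n : ℝ)) atTop (𝓝 0) := by
    simp only [hcount]
    exact hB.tendsto_div_nhds_zero.comp tendsto_natCast_atTop_atTop
  have h := LSeries_tendsto_sub_mul_nhds_one_of_tendsto_sum_div_and_nonneg
    (fun k => if BMem θ k then (1 : ℝ) else 0) hlim (fun k => by positivity)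
  have h' := (Complex.continuous_re.tendsto _).comp h
  rw [Complex.ofReal_zero, Complex.zero_re] at h'
  refine h'.congr' ?_
  filter_upwards [self_mem_nhdsWithin] with s hs
  have hs : 1 < s := hs
  have : LSeries (fun k => ((if BMem θ k then (1 : ℝ) else 0 : ℝ) : ℂ)) s =
      ((∑' n : ℕ, if BMem θ n then (n : ℝ) ^ (-s) else 0 : ℝ) : ℂ) := by
    rw [LSeries, Complex.ofReal_tsum]
    refine tsum_congr fun n => ?_
    rw [LSeries.term_def]
    by_cases hn : BMem θ n
    · rw [if_neg hn.1.ne', if_pos hn, if_pos hn, Complex.ofReal_cpow (Nat.cast_nonneg n)]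
      push_cast
      rw [Complex.cpow_neg, one_div]
    · simp [hn]
  simp only [Function.comp]
  rw [this]
  norm_cast

/-- The part of `bTerm` with `θ n ≤ exp(1/(s-1))`. -/
noncomputable def truncTerm (θ : ℕ → WithTop ℝ) (s : ℝ) (n : ℕ) : ℝ :=
  if θ n ≤ (Real.exp (1 / (s - 1)) : ℝ) then bTerm θ s n else 0

lemma truncTerm_nonneg (hs : 0 < s) (n : ℕ) : 0 ≤ truncTerm θ s n := by
  unfold truncTerm
  split_ifs
  · exact bTerm_nonneg hs n
  · exact le_rfl

lemma truncTerm_le_bTerm (hs : 0 < s) (n : ℕ) : truncTerm θ s n ≤ bTerm θ s n := by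
  unfold truncTerm
  split_ifs
  · exact le_rfl
  · exact bTerm_nonneg hs n

lemma truncTerm_le_const_mul (hs : 1 < s) (hs2 : s ≤ 2) (n : ℕ) :
    truncTerm θ s n ≤ Real.exp (2 + 2 * Real.log 4) * bTerm θ 1 n := by
  have hnn : 0 ≤ Real.exp (2 + 2 * Real.log 4) * bTerm θ 1 n :=
    mul_nonneg (Real.exp_pos _).le (bTerm_nonneg one_pos n)
  unfold truncTerm
  split_ifs with hθ
  swap
  · exact hnn
  unfold bTerm at hnn ⊢
  split_ifs with hn
  swap
  · simp
  have hn1 : (1 : ℝ) ≤ n := by exact_mod_cast hn.1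
  have hle := tprod_eulerFactor_le_const_mul (T := LeTheta θ n) hs hs2 fun p hp =>
    WithTop.coe_le_coe.1 (le_trans hp hθ)
  calc (n : ℝ) ^ (-s) * ∏' p, eulerFactor (LeTheta θ n) s p
      ≤ (n : ℝ) ^ (-1 : ℝ) * (Real.exp (2 + 2 * Real.log 4) *
          ∏' p, eulerFactor (LeTheta θ n) 1 p) := by
        gcongr
        exact tprod_eulerFactor_nonneg (by linarith)
    _ = _ := by ring

lemma bTerm_le_truncTerm_add (hs : 1 < s) (n : ℕ) :
    bTerm θ s n ≤ truncTerm θ s n +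
      Real.exp 1 * (s - 1) * (if BMem θ n then (n : ℝ) ^ (-s) else 0) := by
  have hs0 : 0 < s - 1 := by linarith
  unfold truncTerm
  split_ifs with hθ hn
  · have : 0 ≤ (n : ℝ) ^ (-s) := Real.rpow_nonneg (Nat.cast_nonneg n) _
    have : 0 ≤ Real.exp 1 * (s - 1) * (n : ℝ) ^ (-s) := by positivity
    linarith
  · simp
  · rename_i hn
    rw [bTerm, if_pos hn, zero_add, mul_comm]
    gcongr
    refine tprod_eulerFactor_le_mul_sub_one hs fun p _ hp => ?_
    exact (WithTop.coe_le_coe.2 hp).trans (not_le.1 hθ).le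
  · rename_i hn
    simp [bTerm, hn]

lemma tendsto_truncTerm (n : ℕ) :
    Tendsto (fun s => truncTerm θ s n) (𝓝[>] 1) (𝓝 (if θ n = ⊤ then 0 else bTerm θ 1 n)) := by
  by_cases hθ : θ n = ⊤
  · simp [truncTerm, hθ]
  rw [if_neg hθ]
  obtain ⟨t, ht⟩ := WithTop.ne_top_iff_exists.1 hθ
  have hlarge : ∀ᶠ s : ℝ in 𝓝[>] 1, t ≤ Real.exp (1 / (s - 1)) := by
    have hsub : Tendsto (fun s : ℝ => s - 1) (𝓝[>] 1) (𝓝[>] 0) := by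
      refine tendsto_nhdsWithin_iff.2 ⟨?_, ?_⟩
      · have : ContinuousAt (fun s : ℝ => s - 1) 1 := by fun_prop
        simpa using this.tendsto.mono_left nhdsWithin_le_nhds
      · filter_upwards [self_mem_nhdsWithin] with s hs
        exact sub_pos.2 (Set.mem_Ioi.1 hs)
    have := Real.tendsto_exp_atTop.comp (tendsto_inv_nhdsGT_zero.comp hsub)
    simpa [Function.comp_def] using this.eventually_ge_atTop t
  have heq : (fun s => bTerm θ s n) =ᶠ[𝓝[>] 1] fun s => truncTerm θ s n := by
    filter_upwards [hlarge] with s hs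
    rw [truncTerm, if_pos]
    rw [← ht]
    exact WithTop.coe_le_coe.2 hs
  refine Tendsto.congr' heq ?_
  by_cases hn : BMem θ n
  · have hn0 : (n : ℝ) ≠ 0 := by exact_mod_cast hn.1.ne'
    have hT : ∀ p, LeTheta θ n p → p ≤ ⌊t⌋₊ := fun p hp => by
      rw [LeTheta, ← ht] at hp
      exact Nat.le_floor (WithTop.coe_le_coe.1 hp)
    simp only [bTerm, if_pos hn, tprod_eulerFactor_eq_prod hT]
    have hc : ContinuousAt (fun s : ℝ => (n : ℝ) ^ (-s) *
        ∏ p ∈ Finset.range (⌊t⌋₊ + 1), eulerFactor (LeTheta θ n) s p) 1 := by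
      refine ContinuousAt.mul ((Real.continuousAt_const_rpow hn0).comp (by fun_prop)) ?_
      refine tendsto_finsetProd _ fun p _ => ?_
      unfold eulerFactor
      split_ifs with hp
      · have hp0 : (p : ℝ) ≠ 0 := by exact_mod_cast hp.1.ne_zero
        have : ContinuousAt (fun s : ℝ => 1 - (p : ℝ) ^ (-s)) 1 :=
          continuousAt_const.sub ((Real.continuousAt_const_rpow hp0).comp (by fun_prop))
        exact this
      · exact tendsto_const_nhds
    exact hc.tendsto.mono_left nhdsWithin_le_nhds
  · simp [bTerm, hn]

/-- If `𝓑` has density zero, the identity `∑ bTerm θ s = 1` extends to `s = 1`. -/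
lemma hasSum_bTerm_one (hθ2 : ∀ n : ℕ, 2 ≤ n → ∀ p ∈ n.primeFactors, LeTheta θ n p)
    (hB : (fun x : ℝ => (Bcount θ x : ℝ)) =o[atTop] (fun x : ℝ => x)) :
    HasSum (bTerm θ 1) 1 := by
  have hsum := summable_bTerm_one hθ2
  have hdom : Tendsto (fun s => ∑' n, truncTerm θ s n) (𝓝[>] 1)
      (𝓝 (∑' n, if θ n = ⊤ then 0 else bTerm θ 1 n)) := by
    refine tendsto_tsum_of_dominated_convergence
      (hsum.mul_left (Real.exp (2 + 2 * Real.log 4))) tendsto_truncTerm ?_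
    filter_upwards [Ioc_mem_nhdsGT one_lt_two] with s hs n
    rw [Real.norm_of_nonneg (truncTerm_nonneg (by linarith [hs.1]) n)]
    exact truncTerm_le_const_mul hs.1 hs.2 n
  have hlim := hdom.add ((tendsto_sub_one_mul_tsum_bMem hB).const_mul (Real.exp 1))
  rw [mul_zero, add_zero] at hlim
  have hge : 1 ≤ ∑' n, if θ n = ⊤ then 0 else bTerm θ 1 n := by
    refine ge_of_tendsto hlim ?_
    filter_upwards [self_mem_nhdsWithin] with s hs
    have hs : 1 < s := hs
    have hs0 : 0 < s := by linarith
    have h1 := hasSum_bTerm hθ2 hs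
    have htr : Summable (truncTerm θ s) :=
      h1.summable.of_nonneg_of_le (truncTerm_nonneg hs0) (truncTerm_le_bTerm hs0)
    have hχ : Summable fun n : ℕ => if BMem θ n then (n : ℝ) ^ (-s) else 0 := by
      refine (summable_rpow_neg hs).of_nonneg_of_le (fun n => ?_) fun n => ?_ <;>
      · have := Real.rpow_nonneg (Nat.cast_nonneg (α := ℝ) n) (-s)
        split_ifs <;> simp [this]
    have hχ' := hχ.mul_left (Real.exp 1 * (s - 1))
    calc (1 : ℝ) = ∑' n, bTerm θ s n := h1.tsum_eq.symm
      _ ≤ ∑' n, (truncTerm θ s n +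
            Real.exp 1 * (s - 1) * (if BMem θ n then (n : ℝ) ^ (-s) else 0)) :=
          h1.summable.tsum_le_tsum (bTerm_le_truncTerm_add hs) (htr.add hχ')
      _ = _ := by rw [htr.tsum_add hχ', tsum_mul_left, mul_assoc]
  have hle : ∀ n, (if θ n = ⊤ then 0 else bTerm θ 1 n) ≤ bTerm θ 1 n := fun n => by
    have := bTerm_nonneg (θ := θ) one_pos n
    split_ifs <;> simp [this]
  have hge' : 1 ≤ ∑' n, bTerm θ 1 n := by
    refine hge.trans (Summable.tsum_le_tsum hle (hsum.of_nonneg_of_le (fun n => ?_) hle) hsum)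
    have := bTerm_nonneg (θ := θ) one_pos n
    split_ifs <;> simp [this]
  have hle' : ∑' n, bTerm θ 1 n ≤ 1 :=
    hsum.tsum_le_of_sum_le (sum_bTerm_one_le hθ2)
  exact hsum.hasSum_iff.2 (le_antisymm hle' hge')

end Series

theorem lemma1_s_eq_one (θ : ℕ → WithTop ℝ)
    (hθ1 : (2 : WithTop ℝ) ≤ θ 1)
    (hθ2 : ∀ n : ℕ, 2 ≤ n → ∀ p ∈ n.primeFactors, ((p : ℝ) : WithTop ℝ) ≤ θ n)
    (hB : (fun x : ℝ => (Bcount θ x : ℝ)) =o[Filter.atTop] (fun x : ℝ => x)) :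
    HasSum (fun n : ℕ =>
      if BMem θ n then
        (1 / (n : ℝ)) *
          ∏' p : ℕ, (if p.Prime ∧ ((p : ℝ) : WithTop ℝ) ≤ θ n then 1 - 1 / (p : ℝ) else 1)
      else 0) 1 := by
  have h := hasSum_bTerm_one hθ2 hB
  convert h using 2 with n
  simp only [bTerm, eulerFactor, LeTheta, Real.rpow_neg_one, one_div]
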